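/- The set of solutions v : ℤ → ℂ^{2n+1} of the recursion k·v(k) + N·v(k) + E·v(k−1) = 0 is a complex vector space on which the evaluation map v ↦ v(0) is a linear isomorphism onto the line ℂ·e_{2n+1} spanned by the last standard basis vector (the kernel of N); in particular the solution space is one-dimensional. -/

import Mathlib

/-- The space of doubly-infinite formal solutions of the Frenkel–Gross recursion,
as a submodule of ℤ → ℂ^m (cut out by the linear conditions
k·v(k) + N·v(k) + E·v(k−1) = 0 for all k). -/
noncomputable def fgSolSpace (m : ℕ) (N E : Matrix (Fin m) (Fin m) ℂ) :
    Submodule ℂ (ℤ → Fin m → ℂ) :=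
  ⨅ k : ℤ, LinearMap.ker
    ((k : ℂ) • (LinearMap.proj k : (ℤ → Fin m → ℂ) →ₗ[ℂ] (Fin m → ℂ))
      + N.mulVecLin.comp (LinearMap.proj k)
      + E.mulVecLin.comp (LinearMap.proj (k - 1)))

/-- Coefficients of the last component for nonnegative indices. -/
noncomputable def fgC (n : ℕ) : ℕ → ℂ
  | 0 => 1
  | k + 1 => (2 * (k : ℂ) + 1) / ((k : ℂ) + 1) ^ (2 * n + 1) * fgC n k

/-- Last component of the basic solution. -/
noncomputable def fgX (n : ℕ) (k : ℤ) : ℂ := if k < 0 then 0 else fgC n k.toNat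

lemma fgX_zero (n : ℕ) : fgX n 0 = 1 := by simp [fgX, fgC]

lemma fgX_nat (n : ℕ) (k : ℕ) : fgX n (k : ℤ) = fgC n k := by
  simp [fgX]

lemma fgX_neg (n : ℕ) (k : ℤ) (hk : k < 0) : fgX n k = 0 := by
  simp [fgX, hk]

lemma fgX_rec (n : ℕ) (k : ℤ) :
    (k : ℂ) ^ (2 * n + 1) * fgX n k = (2 * (k : ℂ) - 1) * fgX n (k - 1) := by
  rcases lt_trichotomy k 0 with h | h | h
  · rw [fgX_neg n k h, fgX_neg n (k - 1) (by omega)]; ring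
  · subst h
    rw [fgX_neg n (0 - 1) (by omega)]; simp
  · obtain ⟨m, rfl⟩ : ∃ m : ℕ, k = (m : ℤ) + 1 := ⟨(k - 1).toNat, by omega⟩
    have h1 : fgX n ((m : ℤ) + 1) = fgC n (m + 1) := by
      rw [← fgX_nat]; push_cast; rfl
    have h2 : (m : ℤ) + 1 - 1 = m := by ring
    rw [h1, h2, fgX_nat, fgC]
    have h3 : ((m : ℂ) + 1) ≠ 0 := by exact_mod_cast Nat.succ_ne_zero m
    push_cast
    field_simp
    ring

lemma fg_rec_unique (n : ℕ) (x : ℤ → ℂ)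
    (hx : ∀ k : ℤ, (k : ℂ) ^ (2 * n + 1) * x k = (2 * (k : ℂ) - 1) * x (k - 1)) (k : ℤ) :
    x k = x 0 * fgX n k := by
  rcases lt_or_ge k 0 with h | h
  · rw [fgX_neg n k h]
    have key : ∀ m : ℕ, x (-(m : ℤ) - 1) = 0 := by
      intro m
      induction m with
      | zero => simpa using hx 0
      | succ m ih =>
        have := hx (-(m : ℤ) - 1)
        rw [ih, mul_zero] at this
        have hne : (2 * ((-(m : ℤ) - 1 : ℤ) : ℂ) - 1) ≠ 0 := by
          have : (2 * (-(m : ℤ) - 1 : ℤ) - 1) ≠ 0 := by omega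
          exact_mod_cast this
        have h0 := (mul_eq_zero.mp this.symm).resolve_left hne
        rw [← h0]; congr 1; push_cast; ring
    obtain ⟨m, rfl⟩ : ∃ m : ℕ, k = -(m : ℤ) - 1 := ⟨(-k - 1).toNat, by omega⟩
    rw [key, mul_zero]
  · obtain ⟨m, rfl⟩ : ∃ m : ℕ, k = (m : ℤ) := ⟨k.toNat, by omega⟩
    clear h
    induction m with
    | zero => simp [fgX_zero]
    | succ m ih =>
      have h1 := hx ((m + 1 : ℕ) : ℤ)
      have h2 := fgX_rec n ((m + 1 : ℕ) : ℤ)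
      have h3 : ((m + 1 : ℕ) : ℤ) - 1 = m := by push_cast; ring
      rw [h3] at h1 h2
      have hne : ((((m + 1 : ℕ) : ℤ) : ℂ)) ^ (2 * n + 1) ≠ 0 := by
        apply pow_ne_zero
        exact_mod_cast Nat.succ_ne_zero m
      apply mul_left_cancel₀ hne
      rw [h1, ih, mul_left_comm, mul_left_comm _ (x 0), h2]

lemma fgN_zero (n : ℕ) (N : Matrix (Fin (2 * n + 1)) (Fin (2 * n + 1)) ℂ)
    (hNdef : ∀ i j : Fin (2 * n + 1), N i j = if (i : ℕ) = (j : ℕ) + 1 then 1 else 0)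
    (u : Fin (2 * n + 1) → ℂ) (h : 0 < 2 * n + 1) : N.mulVec u ⟨0, h⟩ = 0 := by
  simp [Matrix.mulVec, dotProduct, hNdef]

lemma fgN_succ (n : ℕ) (N : Matrix (Fin (2 * n + 1)) (Fin (2 * n + 1)) ℂ)
    (hNdef : ∀ i j : Fin (2 * n + 1), N i j = if (i : ℕ) = (j : ℕ) + 1 then 1 else 0)
    (u : Fin (2 * n + 1) → ℂ) (i : ℕ) (h : i + 1 < 2 * n + 1) :
    N.mulVec u ⟨i + 1, h⟩ = u ⟨i, by omega⟩ := by
  simp only [Matrix.mulVec, dotProduct, hNdef]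
  rw [Finset.sum_eq_single ⟨i, by omega⟩]
  · simp
  · intro b _ hb
    have : ¬ (i + 1 = (b : ℕ) + 1) := fun h' => hb (Fin.ext (by simp; omega))
    rw [if_neg this, zero_mul]
  · simp

lemma fgE_zero (n : ℕ) (hn : 1 ≤ n) (E : Matrix (Fin (2 * n + 1)) (Fin (2 * n + 1)) ℂ)
    (hEdef : ∀ i j : Fin (2 * n + 1), E i j =
      if ((i : ℕ) = 0 ∧ (j : ℕ) = 2 * n - 1) ∨ ((i : ℕ) = 1 ∧ (j : ℕ) = 2 * n)
      then 1 else 0)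
    (u : Fin (2 * n + 1) → ℂ) (h : 0 < 2 * n + 1) :
    E.mulVec u ⟨0, h⟩ = u ⟨2 * n - 1, by omega⟩ := by
  simp only [Matrix.mulVec, dotProduct, hEdef]
  rw [Finset.sum_eq_single ⟨2 * n - 1, by omega⟩]
  · simp
  · intro b _ hb
    have : (b : ℕ) ≠ 2 * n - 1 := fun h' => hb (Fin.ext h')
    rw [if_neg (by omega), zero_mul]
  · simp

lemma fgE_one (n : ℕ) (E : Matrix (Fin (2 * n + 1)) (Fin (2 * n + 1)) ℂ)
    (hEdef : ∀ i j : Fin (2 * n + 1), E i j =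
      if ((i : ℕ) = 0 ∧ (j : ℕ) = 2 * n - 1) ∨ ((i : ℕ) = 1 ∧ (j : ℕ) = 2 * n)
      then 1 else 0)
    (u : Fin (2 * n + 1) → ℂ) (h : 0 + 1 < 2 * n + 1) :
    E.mulVec u ⟨0 + 1, h⟩ = u ⟨2 * n, by omega⟩ := by
  simp only [Matrix.mulVec, dotProduct, hEdef]
  rw [Finset.sum_eq_single ⟨2 * n, by omega⟩]
  · simp
  · intro b _ hb
    have : (b : ℕ) ≠ 2 * n := fun h' => hb (Fin.ext h')
    rw [if_neg (by omega), zero_mul]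
  · simp

lemma fgE_succ (n : ℕ) (E : Matrix (Fin (2 * n + 1)) (Fin (2 * n + 1)) ℂ)
    (hEdef : ∀ i j : Fin (2 * n + 1), E i j =
      if ((i : ℕ) = 0 ∧ (j : ℕ) = 2 * n - 1) ∨ ((i : ℕ) = 1 ∧ (j : ℕ) = 2 * n)
      then 1 else 0)
    (u : Fin (2 * n + 1) → ℂ) (i : ℕ) (h : i + 1 + 1 < 2 * n + 1) :
    E.mulVec u ⟨i + 1 + 1, h⟩ = 0 := by
  simp [Matrix.mulVec, dotProduct, hEdef]

/-- The solution with last component `x`. -/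
noncomputable def fgW (n : ℕ) (x : ℤ → ℂ) (k : ℤ) (i : Fin (2 * n + 1)) : ℂ :=
  if (i : ℕ) = 0 then (k : ℂ) ^ (2 * n) * x k - x (k - 1) else (-(k : ℂ)) ^ (2 * n - i) * x k

lemma fg_sol_form (n : ℕ) (hn : 1 ≤ n)
    (N E : Matrix (Fin (2 * n + 1)) (Fin (2 * n + 1)) ℂ)
    (hNdef : ∀ i j : Fin (2 * n + 1), N i j = if (i : ℕ) = (j : ℕ) + 1 then 1 else 0)
    (hEdef : ∀ i j : Fin (2 * n + 1), E i j =
      if ((i : ℕ) = 0 ∧ (j : ℕ) = 2 * n - 1) ∨ ((i : ℕ) = 1 ∧ (j : ℕ) = 2 * n)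
      then 1 else 0)
    (v : ℤ → Fin (2 * n + 1) → ℂ)
    (hv : ∀ k : ℤ, (k : ℂ) • v k + N.mulVec (v k) + E.mulVec (v (k - 1)) = 0) :
    v = v 0 (Fin.last (2 * n)) • fgW n (fgX n) := by
  have e0 : ∀ k : ℤ, (k : ℂ) * v k ⟨0, by omega⟩ + v (k - 1) ⟨2 * n - 1, by omega⟩ = 0 := by
    intro k
    have := congrFun (hv k) ⟨0, by omega⟩
    simpa only [Pi.add_apply, Pi.smul_apply, smul_eq_mul, Pi.zero_apply, fgN_zero n N hNdef,
      fgE_zero n hn E hEdef, add_zero] using this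
  have e1 : ∀ k : ℤ, (k : ℂ) * v k ⟨0 + 1, by omega⟩ + v k ⟨0, by omega⟩
      + v (k - 1) ⟨2 * n, by omega⟩ = 0 := by
    intro k
    have := congrFun (hv k) ⟨0 + 1, by omega⟩
    simpa only [Pi.add_apply, Pi.smul_apply, smul_eq_mul, Pi.zero_apply, fgN_succ n N hNdef,
      fgE_one n E hEdef] using this
  have e2 : ∀ (k : ℤ) (i : ℕ) (h : i + 1 + 1 < 2 * n + 1),
      (k : ℂ) * v k ⟨i + 1 + 1, h⟩ + v k ⟨i + 1, by omega⟩ = 0 := by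
    intro k i h
    have := congrFun (hv k) ⟨i + 1 + 1, h⟩
    simpa only [Pi.add_apply, Pi.smul_apply, smul_eq_mul, Pi.zero_apply, fgN_succ n N hNdef,
      fgE_succ n E hEdef, add_zero] using this
  have f : ∀ (k : ℤ) (d i : ℕ) (hd : i + 1 + d = 2 * n),
      v k ⟨i + 1, by omega⟩ = (-(k : ℂ)) ^ d * v k (Fin.last (2 * n)) := by
    intro k d
    induction d with
    | zero =>
      intro i hd
      have : (⟨i + 1, by omega⟩ : Fin (2 * n + 1)) = Fin.last (2 * n) := Fin.ext (by simpa using hd)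
      rw [this]; simp
    | succ d ih =>
      intro i hd
      have h1 := ih (i + 1) (by omega)
      have h2 := e2 k i (by omega)
      rw [h1] at h2
      rw [pow_succ]
      linear_combination h2
  have f0 : ∀ k : ℤ, v k ⟨0, by omega⟩ =
      (k : ℂ) ^ (2 * n) * v k (Fin.last (2 * n)) - v (k - 1) (Fin.last (2 * n)) := by
    intro k
    have h1 := e1 k
    rw [f k (2 * n - 1) 0 (by omega)] at h1
    have h2 : (-(k : ℂ)) ^ (2 * n) = (-(k : ℂ)) ^ (2 * n - 1) * (-(k : ℂ)) := by
      rw [← pow_succ]; congr 1; omega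
    rw [Even.neg_pow ⟨n, by ring⟩] at h2
    rw [h2]
    have h3 : (⟨2 * n, by omega⟩ : Fin (2 * n + 1)) = Fin.last (2 * n) := rfl
    rw [h3] at h1
    linear_combination h1
  have hrec := fg_rec_unique n (fun k => v k (Fin.last (2 * n))) (by
    intro k
    have h1 := e0 k
    have h3 : (⟨2 * n - 1, by omega⟩ : Fin (2 * n + 1)) = ⟨(2 * n - 2) + 1, by omega⟩ :=
      Fin.ext (by simp; omega)
    rw [f0, h3, f (k - 1) 1 (2 * n - 2) (by omega)] at h1
    push_cast at h1
    linear_combination h1)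
  funext k ⟨i, hi⟩
  rcases i with _ | i
  · rw [f0, hrec k, hrec (k - 1)]
    simp [fgW]; ring
  · rw [f k (2 * n - (i + 1)) i (by omega), hrec k]
    simp [fgW]; ring

lemma fgW_sol (n : ℕ) (hn : 1 ≤ n)
    (N E : Matrix (Fin (2 * n + 1)) (Fin (2 * n + 1)) ℂ)
    (hNdef : ∀ i j : Fin (2 * n + 1), N i j = if (i : ℕ) = (j : ℕ) + 1 then 1 else 0)
    (hEdef : ∀ i j : Fin (2 * n + 1), E i j =
      if ((i : ℕ) = 0 ∧ (j : ℕ) = 2 * n - 1) ∨ ((i : ℕ) = 1 ∧ (j : ℕ) = 2 * n)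
      then 1 else 0) (k : ℤ) :
    (k : ℂ) • fgW n (fgX n) k + N.mulVec (fgW n (fgX n) k)
      + E.mulVec (fgW n (fgX n) (k - 1)) = 0 := by
  funext ⟨i, hi⟩
  rcases i with _ | _ | i
  · simp only [Pi.add_apply, Pi.smul_apply, smul_eq_mul, Pi.zero_apply, fgN_zero n N hNdef,
      fgE_zero n hn E hEdef, add_zero]
    have h1 : ¬ (2 * n - 1 = 0) := by omega
    have h2 : 2 * n - (2 * n - 1) = 1 := by omega
    simp only [fgW, if_true, h1, if_false, h2]
    have := fgX_rec n k
    push_cast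
    linear_combination this
  · simp only [Pi.add_apply, Pi.smul_apply, smul_eq_mul, Pi.zero_apply, fgN_succ n N hNdef,
      fgE_one n E hEdef]
    have h1 : ¬ (2 * n = 0) := by omega
    have h2 : (-(k : ℂ)) ^ (2 * n) = (-(k : ℂ)) ^ (2 * n - 1) * (-(k : ℂ)) := by
      rw [← pow_succ]; congr 1; omega
    rw [Even.neg_pow ⟨n, by ring⟩] at h2
    simp only [fgW, if_true, h1, if_false, zero_add, one_ne_zero, h2, Nat.sub_self, pow_zero]
    ring
  · simp only [Pi.add_apply, Pi.smul_apply, smul_eq_mul, Pi.zero_apply, fgN_succ n N hNdef,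
      fgE_succ n E hEdef, add_zero]
    have h2 : (-(k : ℂ)) ^ (2 * n - (i + 1)) = (-(k : ℂ)) ^ (2 * n - (i + 1 + 1)) * (-(k : ℂ)) := by
      rw [← pow_succ]; congr 1; omega
    simp only [fgW, Nat.add_eq_zero_iff, one_ne_zero, and_false, if_false, h2]
    ring

lemma fgW_zero (n : ℕ) (hn : 1 ≤ n) :
    fgW n (fgX n) 0 = Pi.single (Fin.last (2 * n)) (1 : ℂ) := by
  funext i
  rw [Pi.single_apply]
  have hn0 : n ≠ 0 := by omega
  by_cases h : i = Fin.last (2 * n)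
  · subst h
    simp [fgW, hn0, fgX_zero]
  · have h' : (i : ℕ) ≠ 2 * n := fun h' => h (Fin.ext h')
    have h3 : 2 * n - (i : ℕ) ≠ 0 := by have := i.2; omega
    rw [if_neg h]
    simp [fgW, hn0, fgX_neg, h3]

/-- For the standard representation of SO_{2n+1}, the solution space of the
Frenkel–Gross recursion is mapped by evaluation at 0 linearly and isomorphically
onto the line spanned by the last standard basis vector (the kernel of N);
in particular the solution space is one-dimensional. -/
theorem stmt_5 (n : ℕ) (hn : 1 ≤ n)
    (N E : Matrix (Fin (2 * n + 1)) (Fin (2 * n + 1)) ℂ)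
    (hNdef : ∀ i j : Fin (2 * n + 1), N i j = if (i : ℕ) = (j : ℕ) + 1 then 1 else 0)
    (hEdef : ∀ i j : Fin (2 * n + 1), E i j =
      if ((i : ℕ) = 0 ∧ (j : ℕ) = 2 * n - 1) ∨ ((i : ℕ) = 1 ∧ (j : ℕ) = 2 * n)
      then 1 else 0) :
    (∀ v : ℤ → Fin (2 * n + 1) → ℂ, v ∈ fgSolSpace (2 * n + 1) N E ↔
        ∀ k : ℤ, (k : ℂ) • v k + N.mulVec (v k) + E.mulVec (v (k - 1)) = 0)
    ∧ Function.Injective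
        (((LinearMap.proj (0 : ℤ) : (ℤ → Fin (2 * n + 1) → ℂ) →ₗ[ℂ] (Fin (2 * n + 1) → ℂ))).comp
          (fgSolSpace (2 * n + 1) N E).subtype)
    ∧ LinearMap.range
        (((LinearMap.proj (0 : ℤ) : (ℤ → Fin (2 * n + 1) → ℂ) →ₗ[ℂ] (Fin (2 * n + 1) → ℂ))).comp
          (fgSolSpace (2 * n + 1) N E).subtype)
        = Submodule.span ℂ {Pi.single (Fin.last (2 * n)) (1 : ℂ)}
    ∧ Module.finrank ℂ (fgSolSpace (2 * n + 1) N E) = 1 := by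
  have hmem : ∀ v : ℤ → Fin (2 * n + 1) → ℂ, v ∈ fgSolSpace (2 * n + 1) N E ↔
      ∀ k : ℤ, (k : ℂ) • v k + N.mulVec (v k) + E.mulVec (v (k - 1)) = 0 := by
    intro v
    simp [fgSolSpace, Submodule.mem_iInf]
  have hform := fun v hv => fg_sol_form n hn N E hNdef hEdef v ((hmem v).1 hv)
  have hw : fgW n (fgX n) ∈ fgSolSpace (2 * n + 1) N E :=
    (hmem _).2 (fgW_sol n hn N E hNdef hEdef)
  have hinj : Function.Injective
      (((LinearMap.proj (0 : ℤ) : (ℤ → Fin (2 * n + 1) → ℂ) →ₗ[ℂ] (Fin (2 * n + 1) → ℂ))).comp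
        (fgSolSpace (2 * n + 1) N E).subtype) := by
    rintro ⟨v, hv⟩ ⟨u, hu⟩ h
    have h' : v 0 = u 0 := h
    apply Subtype.ext
    show v = u
    rw [hform v hv, hform u hu, h']
  have hrange : LinearMap.range
      (((LinearMap.proj (0 : ℤ) : (ℤ → Fin (2 * n + 1) → ℂ) →ₗ[ℂ] (Fin (2 * n + 1) → ℂ))).comp
        (fgSolSpace (2 * n + 1) N E).subtype)
      = Submodule.span ℂ {Pi.single (Fin.last (2 * n)) (1 : ℂ)} := by
    apply le_antisymm
    · rintro _ ⟨⟨v, hv⟩, rfl⟩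
      rw [Submodule.mem_span_singleton]
      refine ⟨v 0 (Fin.last (2 * n)), ?_⟩
      show _ = v 0
      rw [← fgW_zero n hn]
      exact (congrFun (hform v hv) 0).symm
    · rw [Submodule.span_le, Set.singleton_subset_iff]
      exact ⟨⟨_, hw⟩, fgW_zero n hn⟩
  refine ⟨hmem, hinj, hrange, ?_⟩
  rw [← LinearMap.finrank_range_of_inj hinj, hrange]
  apply finrank_span_singleton
  intro h
  have := congrFun h (Fin.last (2 * n))
  simp at this
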